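/- Let N = 2 and q ∈ ℂ*. The restriction of the natural Hopf algebra surjection π : O(GL_q) → O(SL_q) = O(GL_q)/⟨det_q − 1⟩ maps O(D\GL_q) isomorphically onto O(K\SL_q). -/

import Mathlib

open TensorProduct

noncomputable section

/-- Number of inversions (the length) of a permutation of `Fin t`. -/
def invCount {t : ℕ} (σ : Equiv.Perm (Fin t)) : ℕ :=
  (Finset.univ.filter fun p : Fin t × Fin t => p.1 < p.2 ∧ σ p.2 < σ p.1).card

/-- The principal quantum minor `[I|I]` of the matrix of generators `x`. -/
def qMinor {A : Type} [CommRing A] {M : Type} [Ring M] [Algebra A M] {N : ℕ}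
    (q : A) (x : Fin N → Fin N → M) (I : Finset (Fin N)) : M :=
  ∑ σ : Equiv.Perm (Fin I.card),
    ((-q) ^ invCount σ) •
      ((List.finRange I.card).map fun k =>
        x ((I.orderIsoOfFin rfl) k).1 ((I.orderIsoOfFin rfl) (σ k)).1).prod

/-- The quantum determinant. -/
def qdet {A : Type} [CommRing A] {M : Type} [Ring M] [Algebra A M] {N : ℕ}
    (q : A) (x : Fin N → Fin N → M) : M :=
  qMinor q x Finset.univ

/-- `w(I)`: the sum of the elements of `I` (with `{1, …, N}` indexing). -/
def wtSet {N : ℕ} (I : Finset (Fin N)) : ℕ := ∑ j ∈ I, (j.1 + 1)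

/-- The weighted sum `τ_i` of principal quantum minors of size `i`. -/
def tauCoinv {A : Type} [CommRing A] {M : Type} [Ring M] [Algebra A M] {N : ℕ}
    (q qinv : A) (x : Fin N → Fin N → M) (i : ℕ) : M :=
  ∑ I ∈ Finset.univ.filter (fun I : Finset (Fin N) => I.card = i),
    qinv ^ (2 * wtSet I) • qMinor q x I

/-- The sum `σ_i` of all principal quantum minors of size `i`. -/
def sigmaCoinv {A : Type} [CommRing A] {M : Type} [Ring M] [Algebra A M] {N : ℕ}
    (q : A) (x : Fin N → Fin N → M) (i : ℕ) : M :=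
  ∑ I ∈ Finset.univ.filter (fun I : Finset (Fin N) => I.card = i), qMinor q x I

/-- The right adjoint coaction `β(h) = Σ h₂ ⊗ S(h₁)h₃`. -/
def adjBeta {A : Type} [CommRing A] {M G : Type} [Ring M] [Algebra A M] [Ring G] [Algebra A G]
    (ΔM : M →ₐ[A] M ⊗[A] M) (ι : M →ₐ[A] G) (St : G →ₗ[A] G) : M →ₗ[A] M ⊗[A] G :=
  TensorProduct.map LinearMap.id (LinearMap.mul' A G) ∘ₗ
  (TensorProduct.assoc A M G G).toLinearMap ∘ₗ
  TensorProduct.map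
    ((TensorProduct.comm A G M).toLinearMap ∘ₗ
      TensorProduct.map (St ∘ₗ ι.toLinearMap) LinearMap.id)
    ι.toLinearMap ∘ₗ
  TensorProduct.map ΔM.toLinearMap LinearMap.id ∘ₗ ΔM.toLinearMap

/-- The right coaction `α(h) = Σ h₂ ⊗ h₃S(h₁)`. -/
def adjAlpha {A : Type} [CommRing A] {M G : Type} [Ring M] [Algebra A M] [Ring G] [Algebra A G]
    (ΔM : M →ₐ[A] M ⊗[A] M) (ι : M →ₐ[A] G) (St : G →ₗ[A] G) : M →ₗ[A] M ⊗[A] G :=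
  TensorProduct.map LinearMap.id (LinearMap.mul' A G) ∘ₗ
  TensorProduct.map LinearMap.id (TensorProduct.comm A G G).toLinearMap ∘ₗ
  (TensorProduct.assoc A M G G).toLinearMap ∘ₗ
  TensorProduct.map
    ((TensorProduct.comm A G M).toLinearMap ∘ₗ
      TensorProduct.map (St ∘ₗ ι.toLinearMap) LinearMap.id)
    ι.toLinearMap ∘ₗ
  TensorProduct.map ΔM.toLinearMap LinearMap.id ∘ₗ ΔM.toLinearMap

/-- The co-orbit map associated to a point `e = ev_ξ` and a coaction `b`. -/
def coorbit {A : Type} [CommRing A] {M G : Type} [Ring M] [Algebra A M] [Ring G] [Algebra A G]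
    (e : M →ₐ[A] A) (b : M →ₗ[A] M ⊗[A] G) : M →ₗ[A] G :=
  (TensorProduct.lid A G).toLinearMap ∘ₗ TensorProduct.map e.toLinearMap LinearMap.id ∘ₗ b

/-- The left coaction `λ_D = (π_D ⊗ id) ∘ Δ` of a quotient Hopf algebra. -/
def leftCoact {A : Type} [CommRing A] {G D : Type} [Ring G] [Algebra A G]
    [CommRing D] [Algebra A D]
    (πD : G →ₐ[A] D) (ΔG : G →ₐ[A] G ⊗[A] G) : G →ₗ[A] D ⊗[A] G :=
  TensorProduct.map πD.toLinearMap LinearMap.id ∘ₗ ΔG.toLinearMap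

/-- Coinvariants of the left coaction `λ_D`. -/
def dCoinv {A : Type} [CommRing A] {G D : Type} [Ring G] [Algebra A G]
    [CommRing D] [Algebra A D]
    (πD : G →ₐ[A] D) (ΔG : G →ₐ[A] G ⊗[A] G) : Set G :=
  {f : G | leftCoact πD ΔG f = (1 : D) ⊗ₜ[A] f}

/-- The right coaction `ρ_D = (id ⊗ π_D) ∘ Δ`. -/
def rightCoact {A : Type} [CommRing A] {G D : Type} [Ring G] [Algebra A G]
    [CommRing D] [Algebra A D]
    (πD : G →ₐ[A] D) (ΔG : G →ₐ[A] G ⊗[A] G) : G →ₗ[A] G ⊗[A] D :=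
  TensorProduct.map LinearMap.id πD.toLinearMap ∘ₗ ΔG.toLinearMap

/-- The weight space of weight `ta : D` for the grading induced by `ρ_D`. -/
def weightSpace' {A : Type} [CommRing A] {G D : Type} [Ring G] [Algebra A G]
    [CommRing D] [Algebra A D]
    (πD : G →ₐ[A] D) (ΔG : G →ₐ[A] G ⊗[A] G) (ta : D) : Submodule A G :=
  LinearMap.ker (rightCoact πD ΔG - (TensorProduct.mk A G D).flip ta)

/-- The subcomodule generated by a subset `s` of the comodule `(M, b)`. -/
def comodGen {A : Type} [CommRing A] {M G : Type} [Ring M] [Algebra A M] [Ring G] [Algebra A G]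
    (b : M →ₗ[A] M ⊗[A] G) (s : Set M) : Submodule A M :=
  sInf {W : Submodule A M | s ⊆ W ∧
    ∀ w ∈ W, b w ∈ LinearMap.range (TensorProduct.map W.subtype (LinearMap.id : G →ₗ[A] G))}

theorem qdet_fin_two {M : Type} [Ring M] [Algebra ℂ M] (q : ℂ) (x : Fin 2 → Fin 2 → M) :
    qdet q x = x 0 0 * x 1 1 - q • (x 0 1 * x 1 0) := by
  have he : ∀ k : Fin 2,
      (((Finset.univ : Finset (Fin 2)).orderIsoOfFin (rfl : _ = 2)) k).1 = k := by
    intro k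
    have h := Finset.orderEmbOfFin_unique (s := (Finset.univ : Finset (Fin 2))) (k := 2) rfl
      (f := id) (fun _ => Finset.mem_univ _) strictMono_id
    exact (congrFun h k).symm
  change ∑ σ : Equiv.Perm (Fin 2), ((-q) ^ invCount σ) •
    ((List.finRange 2).map fun k =>
      x (((Finset.univ : Finset (Fin 2)).orderIsoOfFin (rfl : _ = 2)) k).1
        (((Finset.univ : Finset (Fin 2)).orderIsoOfFin (rfl : _ = 2)) (σ k)).1).prod = _
  simp only [he]
  have hu : (Finset.univ : Finset (Equiv.Perm (Fin 2))) = {1, Equiv.swap 0 1} := by decide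
  have h1 : invCount (1 : Equiv.Perm (Fin 2)) = 0 := by decide
  have h2 : invCount (Equiv.swap (0 : Fin 2) 1) = 1 := by decide
  have hf : List.finRange 2 = [0, 1] := by decide
  rw [hu, Finset.sum_pair (by decide), h1, h2, hf]
  simp [sub_eq_add_neg]

/-- The quantum determinant commutes with every generator of quantum `2 × 2` matrices. -/
theorem commute_qdet {M : Type} [Ring M] [Algebra ℂ M] {q : ℂ} (hq : q ≠ 0)
    {x : Fin 2 → Fin 2 → M}
    (hrow : ∀ i j l : Fin 2, j < l → x i j * x i l = q • (x i l * x i j))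
    (hcol : ∀ i k j : Fin 2, i < k → x i j * x k j = q • (x k j * x i j))
    (hanti : ∀ i k j l : Fin 2, i < k → j < l → x i l * x k j = x k j * x i l)
    (hdiag : ∀ i k j l : Fin 2, i < k → j < l →
      x i j * x k l - x k l * x i j = (q - q⁻¹) • (x i l * x k j)) (i j : Fin 2) :
    Commute (qdet q x) (x i j) := by
  rw [qdet_fin_two]
  suffices h : ∀ a b c d : M, a * b = q • (b * a) → c * d = q • (d * c) →
      a * c = q • (c * a) → b * d = q • (d * b) → b * c = c * b →
      a * d = d * a + (q - q⁻¹) • (c * b) →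
      Commute (a * d - q • (b * c)) a ∧ Commute (a * d - q • (b * c)) b ∧
      Commute (a * d - q • (b * c)) c ∧ Commute (a * d - q • (b * c)) d by
    have hbc := hanti 0 1 0 1 (by decide) (by decide)
    obtain ⟨ha, hb, hc, hd⟩ := h _ _ _ _ (hrow 0 0 1 (by decide)) (hrow 1 0 1 (by decide))
      (hcol 0 1 0 (by decide)) (hcol 0 1 1 (by decide)) hbc
      (by rw [← hbc, ← hdiag 0 1 0 1 (by decide) (by decide)]; abel)
    fin_cases i <;> fin_cases j
    exacts [ha, hb, hc, hd]
  intro a b c d hab hcd hac hbd hbc had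
  have hcd' : ∀ z, c * (d * z) = q • (d * (c * z)) := fun z => by
    rw [← mul_assoc, hcd, smul_mul_assoc, mul_assoc]
  have hac' : ∀ z, a * (c * z) = q • (c * (a * z)) := fun z => by
    rw [← mul_assoc, hac, smul_mul_assoc, mul_assoc]
  have hbd' : ∀ z, b * (d * z) = q • (d * (b * z)) := fun z => by
    rw [← mul_assoc, hbd, smul_mul_assoc, mul_assoc]
  have hbc' : ∀ z, b * (c * z) = c * (b * z) := fun z => by
    rw [← mul_assoc, hbc, mul_assoc]
  have had' : ∀ z, a * (d * z) = d * (a * z) + (q - q⁻¹) • (c * (b * z)) := fun z => by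
    rw [← mul_assoc, had, add_mul, smul_mul_assoc, mul_assoc, mul_assoc]
  refine ⟨?_, ?_, ?_, ?_⟩ <;>
    simp only [commute_iff_eq, sub_mul, mul_sub, mul_add, add_mul, smul_mul_assoc, mul_smul_comm,
      mul_assoc, hab, hac, hbd, hbc, had, hcd', hac', hbd', hbc', had', smul_smul] <;>
    match_scalars <;> field_simp <;> ring

/-- `N = 2`: the natural surjection `π : O(GL_q) → O(SL_q)` maps `O(D\GL_q)`
isomorphically onto `O(K\SL_q)`. -/
theorem restriction_pi_quotient_spaces
    (q : ℂ) (hq : q ≠ 0)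
    (M G : Type) [Ring M] [Algebra ℂ M] [Ring G] [Algebra ℂ G]
    (x : Fin 2 → Fin 2 → M)
    (hrow : ∀ i j l : Fin 2, j < l → x i j * x i l = (q) • (x i l * x i j))
    (hcol : ∀ i k j : Fin 2, i < k → x i j * x k j = (q) • (x k j * x i j))
    (hanti : ∀ i k j l : Fin 2, i < k → j < l → x i l * x k j = x k j * x i l)
    (hdiag : ∀ i k j l : Fin 2, i < k → j < l →
      x i j * x k l - x k l * x i j = ((q) - (q⁻¹)) • (x i l * x k j))
    (hgen : Algebra.adjoin ℂ (Set.range fun p : Fin 2 × Fin 2 => x p.1 p.2) = ⊤)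
    (hfree : ∀ (B : Type) [Ring B] [Algebra ℂ B] (y : Fin 2 → Fin 2 → B),
      (∀ i j l : Fin 2, j < l → y i j * y i l = (q) • (y i l * y i j)) →
      (∀ i k j : Fin 2, i < k → y i j * y k j = (q) • (y k j * y i j)) →
      (∀ i k j l : Fin 2, i < k → j < l → y i l * y k j = y k j * y i l) →
      (∀ i k j l : Fin 2, i < k → j < l →
        y i j * y k l - y k l * y i j = ((q) - (q⁻¹)) • (y i l * y k j)) →
      ∃! φ : M →ₐ[ℂ] B, ∀ i j, φ (x i j) = y i j)
    (ι : M →ₐ[ℂ] G) (dInv : G)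
    (hd1 : ι (qdet (q) x) * dInv = 1)
    (hd2 : dInv * ι (qdet (q) x) = 1)
    (hgenG : Algebra.adjoin ℂ
      (Set.range (fun p : Fin 2 × Fin 2 => ι (x p.1 p.2)) ∪ {dInv}) = ⊤)
    (hfreeG : ∀ (B : Type) [Ring B] [Algebra ℂ B] (φ : M →ₐ[ℂ] B) (u : B),
      φ (qdet (q) x) * u = 1 → u * φ (qdet (q) x) = 1 →
      ∃! ψ : G →ₐ[ℂ] B, ψ.comp ι = φ)
    (ΔM : M →ₐ[ℂ] M ⊗[ℂ] M)
    (hΔM : ∀ i j, ΔM (x i j) = ∑ k, x i k ⊗ₜ[ℂ] x k j)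
    (ΔG : G →ₐ[ℂ] G ⊗[ℂ] G)
    (hΔG : ∀ m, ΔG (ι m) = Algebra.TensorProduct.map ι ι (ΔM m))
    (εG : G →ₐ[ℂ] ℂ)
    (hεG : ∀ i j, εG (ι (x i j)) = if i = j then 1 else 0)
    (St : G →ₗ[ℂ] G)
    (hS1 : LinearMap.mul' ℂ G ∘ₗ TensorProduct.map St LinearMap.id ∘ₗ ΔG.toLinearMap
      = Algebra.linearMap ℂ G ∘ₗ εG.toLinearMap)
    (hS2 : LinearMap.mul' ℂ G ∘ₗ TensorProduct.map LinearMap.id St ∘ₗ ΔG.toLinearMap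
      = Algebra.linearMap ℂ G ∘ₗ εG.toLinearMap)
    (D : Type) [CommRing D] [Algebra ℂ D]
    (t : Fin 2 → (D)ˣ)
    (πD : G →ₐ[ℂ] D)
    (hπD : ∀ i j, πD (ι (x i j)) = if i = j then (t i : D) else 0)
    (hfreeD : ∀ (B : Type) [CommRing B] [Algebra ℂ B] (u : Fin 2 → Bˣ),
      ∃! φ : D →ₐ[ℂ] B, ∀ i, φ (t i : D) = (u i : B))
    (SL : Type) [Ring SL] [Algebra ℂ SL] (π : G →ₐ[ℂ] SL)
    (hπsurj : Function.Surjective ⇑π)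
    (hπdet : π (ι (qdet q x)) = 1)
    (hfreeSL : ∀ (B : Type) [Ring B] [Algebra ℂ B] (φ : G →ₐ[ℂ] B),
      φ (ι (qdet q x)) = 1 → ∃! ψ : SL →ₐ[ℂ] B, ψ.comp π = φ)
    (ΔSL : SL →ₐ[ℂ] SL ⊗[ℂ] SL)
    (hΔSL : ∀ g, ΔSL (π g) = Algebra.TensorProduct.map π π (ΔG g))
    (πK : SL →ₐ[ℂ] LaurentPolynomial ℂ)
    (hπK00 : πK (π (ι (x 0 0))) = LaurentPolynomial.T 1)
    (hπK01 : πK (π (ι (x 0 1))) = 0)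
    (hπK10 : πK (π (ι (x 1 0))) = 0)
    (hπK11 : πK (π (ι (x 1 1))) = LaurentPolynomial.T (-1)) :
    Set.InjOn ⇑π (dCoinv πD ΔG)
    ∧ ⇑π '' dCoinv πD ΔG = dCoinv πK ΔSL := by
  have extM : ∀ (B : Type) [Ring B] [Algebra ℂ B] (f g : M →ₐ[ℂ] B),
      (∀ i j, f (x i j) = g (x i j)) → f = g := by
    intro B _ _ f g h
    refine AlgHom.ext_of_adjoin_eq_top hgen ?_
    rintro _ ⟨p, rfl⟩
    exact h _ _
  have extG : ∀ (B : Type) [Ring B] [Algebra ℂ B] (f g : G →ₐ[ℂ] B),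
      (∀ i j, f (ι (x i j)) = g (ι (x i j))) → f = g := by
    intro B _ _ f g h
    have hfg : f.comp ι = g.comp ι := extM B _ _ h
    refine (hfreeG B (g.comp ι) (g dInv) ?_ ?_).unique hfg rfl
    · rw [AlgHom.comp_apply, ← map_mul, hd1, map_one]
    · rw [AlgHom.comp_apply, ← map_mul, hd2, map_one]
  have extSL : ∀ (B : Type) [Ring B] [Algebra ℂ B] (f g : SL →ₐ[ℂ] B),
      (∀ i j, f (π (ι (x i j))) = g (π (ι (x i j)))) → f = g := by
    intro B _ _ f g h
    exact (AlgHom.cancel_right hπsurj).1 (extG B (f.comp π) (g.comp π) h)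
  -- the determinant and its inverse are central in `G`
  have cdet : ∀ i j, Commute (ι (qdet q x)) (ι (x i j)) := fun i j =>
    (commute_qdet hq hrow hcol hanti hdiag i j).map ι
  have cinv : ∀ i j, Commute dInv (ι (x i j)) := fun i j =>
    (cdet i j).units_inv_left (u := ⟨ι (qdet q x), dInv, hd1, hd2⟩)
  have centI : ∀ g, Commute dInv g := by
    intro g
    have hg : g ∈ Algebra.adjoin ℂ
      (Set.range (fun p : Fin 2 × Fin 2 => ι (x p.1 p.2)) ∪ {dInv}) := hgenG ▸ trivial
    induction hg using Algebra.adjoin_induction with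
    | mem y hy =>
      rcases hy with ⟨p, rfl⟩ | rfl
      · exact cinv _ _
      · exact Commute.refl _
    | algebraMap r => exact (Algebra.commutes r dInv).symm
    | add _ _ _ _ h1 h2 => exact h1.add_right h2
    | mul _ _ _ _ h1 h2 => exact h1.mul_right h2
  have centD : ∀ g, Commute (ι (qdet q x)) g := fun g =>
    (centI g).units_inv_left (u := ⟨dInv, ι (qdet q x), hd2, hd1⟩)
  -- the section of `π`
  let r : Fin 2 → G := ![dInv, 1]
  have hr : ∀ i g, Commute (r i) g := by
    intro i g
    fin_cases i
    · exact centI g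
    · exact Commute.one_left g
  have hrr : ∀ i k (g h : G), (r i * g) * (r k * h) = (r i * r k) * (g * h) :=
    fun i k g h => ((hr k g).symm).mul_mul_mul_comm _ _
  obtain ⟨φ, hφ, -⟩ := hfree G (fun i j => r i * ι (x i j))
    (fun i j l h => by
      simp only [hrr]
      rw [← map_mul, hrow i j l h, map_smul, mul_smul_comm, map_mul])
    (fun i k j h => by
      simp only [hrr]
      rw [← map_mul, hcol i k j h, map_smul, mul_smul_comm, map_mul, (hr i (r k)).eq])
    (fun i k j l h h' => by
      simp only [hrr]
      rw [← map_mul, hanti i k j l h h', map_mul, (hr i (r k)).eq])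
    (fun i k j l h h' => by
      simp only [hrr]
      rw [(hr k (r i)).eq, ← mul_sub, ← map_mul, ← map_mul, ← map_sub, hdiag i k j l h h',
        map_smul, mul_smul_comm, map_mul])
  have hφdet : φ (qdet q x) = 1 := by
    rw [qdet_fin_two, map_sub, map_smul, map_mul, map_mul]
    simp only [hφ, hrr]
    rw [← mul_smul_comm, ← mul_sub, ← map_mul, ← map_mul, ← map_smul, ← map_sub, ← qdet_fin_two]
    simpa [r] using hd2
  obtain ⟨θ, hθ, -⟩ := hfreeG G φ 1 (by rw [hφdet, one_mul]) (by rw [hφdet, one_mul])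
  have hθ' : ∀ m, θ (ι m) = φ m := DFunLike.congr_fun hθ
  obtain ⟨s, hs, -⟩ := hfreeSL G θ (by rw [hθ', hφdet])
  have hs' : ∀ g, s (π g) = θ g := DFunLike.congr_fun hs
  have hsx : ∀ i j, s (π (ι (x i j))) = r i * ι (x i j) := fun i j => by rw [hs', hθ', hφ]
  have hπr : ∀ i, π (r i) = 1 := by
    intro i
    fin_cases i
    · have h := congrArg π hd1
      rw [map_mul, hπdet, one_mul, map_one] at h
      exact h
    · exact map_one π
  have hπs : ∀ h, π (s h) = h := by
    have : π.comp s = AlgHom.id ℂ SL := extSL _ _ _ fun i j => by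
      simp [hsx, hπr]
    exact DFunLike.congr_fun this
  -- the coactions as algebra homomorphisms
  let lD : G →ₐ[ℂ] D ⊗[ℂ] G := (Algebra.TensorProduct.map πD (AlgHom.id ℂ G)).comp ΔG
  let lK : SL →ₐ[ℂ] LaurentPolynomial ℂ ⊗[ℂ] SL :=
    (Algebra.TensorProduct.map πK (AlgHom.id ℂ SL)).comp ΔSL
  have memD : ∀ f, f ∈ dCoinv πD ΔG ↔ lD f = 1 ⊗ₜ f := fun f => Iff.rfl
  have memK : ∀ f, f ∈ dCoinv πK ΔSL ↔ lK f = 1 ⊗ₜ f := fun f => Iff.rfl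
  have hlD : ∀ i j, lD (ι (x i j)) = (t i : D) ⊗ₜ ι (x i j) := by
    intro i j
    simp only [lD, AlgHom.comp_apply, hΔG, hΔM, map_sum, Algebra.TensorProduct.map_tmul, hπD]
    rw [Finset.sum_eq_single i]
    · simp
    · intro k _ hk
      simp [hk.symm]
    · simp
  let w : Fin 2 → (LaurentPolynomial ℂ)ˣ :=
    ![⟨.T 1, .T (-1), by rw [← LaurentPolynomial.T_add]; simp,
        by rw [← LaurentPolynomial.T_add]; simp⟩,
      ⟨.T (-1), .T 1, by rw [← LaurentPolynomial.T_add]; simp,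
        by rw [← LaurentPolynomial.T_add]; simp⟩]
  have hπK : ∀ i j, πK (π (ι (x i j))) = if i = j then (w i : LaurentPolynomial ℂ) else 0 := by
    intro i j
    fin_cases i <;> fin_cases j
    exacts [hπK00, hπK01, hπK10, hπK11]
  have hlK : ∀ i j, lK (π (ι (x i j))) = (w i : LaurentPolynomial ℂ) ⊗ₜ π (ι (x i j)) := by
    intro i j
    simp only [lK, AlgHom.comp_apply, hΔSL, hΔG, hΔM, map_sum, Algebra.TensorProduct.map_tmul,
      hπK]
    rw [Finset.sum_eq_single i]
    · simp
    · intro k _ hk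
      simp [hk.symm]
    · simp
  clear_value lD lK
  -- `θ` fixes the coinvariants
  have θfix : ∀ f ∈ dCoinv πD ΔG, θ f = f := by
    let dI : (Subalgebra.center ℂ G)ˣ :=
      ⟨⟨dInv, Subalgebra.mem_center_iff.2 fun g => (centI g).eq.symm⟩,
        ⟨ι (qdet q x), Subalgebra.mem_center_iff.2 fun g => (centD g).eq.symm⟩,
        Subtype.ext hd2, Subtype.ext hd1⟩
    obtain ⟨κ, hκ, -⟩ := hfreeD (Subalgebra.center ℂ G) ![dI, 1]
    have hκ' : ∀ i, ((κ (t i) : Subalgebra.center ℂ G) : G) = r i := by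
      intro i
      rw [hκ]
      fin_cases i <;> rfl
    obtain ⟨Λ, hΛt⟩ : ∃ Λ : D ⊗[ℂ] G →ₐ[ℂ] G, ∀ d g, Λ (d ⊗ₜ g) = (κ d : G) * g :=
      ⟨Algebra.TensorProduct.lift ((Subalgebra.center ℂ G).val.comp κ) (AlgHom.id ℂ G)
        fun d g => (Subalgebra.mem_center_iff.1 (κ d).2 g).symm,
        fun _ _ => Algebra.TensorProduct.lift_tmul ..⟩
    have hΛ : θ = Λ.comp lD := extG _ _ _ fun i j => by
      rw [hθ', hφ, AlgHom.comp_apply, hlD, hΛt, hκ']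
    intro f hf
    rw [hΛ, AlgHom.comp_apply, (memD f).1 hf, hΛt, map_one, OneMemClass.coe_one, one_mul]
  refine ⟨fun f hf g hg h => ?_, Set.Subset.antisymm ?_ fun h hh => ⟨s h, ?_, hπs h⟩⟩
  · rw [← θfix f hf, ← θfix g hg, ← hs', ← hs', h]
  · rintro _ ⟨f, hf, rfl⟩
    obtain ⟨μ, hμ, -⟩ := hfreeD (LaurentPolynomial ℂ) w
    have hcomp : lK.comp π = (Algebra.TensorProduct.map μ π).comp lD := extG _ _ _ fun i j => by
      rw [AlgHom.comp_apply, AlgHom.comp_apply, hlK, hlD, Algebra.TensorProduct.map_tmul, hμ]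
    have hf' := DFunLike.congr_fun hcomp f
    rw [AlgHom.comp_apply, AlgHom.comp_apply, (memD f).1 hf, Algebra.TensorProduct.map_tmul,
      map_one] at hf'
    exact (memK _).2 hf'
  · let ν : LaurentPolynomial ℂ →ₐ[ℂ] D :=
      AddMonoidAlgebra.lift ℂ D ℤ ((Units.coeHom D).comp (zpowersHom Dˣ (t 1)⁻¹))
    have hν : ∀ n : ℤ, ν (.T n) = ((((t 1)⁻¹) ^ n : Dˣ) : D) := by
      intro n
      change AddMonoidAlgebra.lift ℂ D ℤ _ (AddMonoidAlgebra.single n 1) = _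
      rw [AddMonoidAlgebra.lift_single, one_smul]
      rfl
    have hlDdet : lD (ι (qdet q x)) = ((t 0 : D) * t 1) ⊗ₜ ι (qdet q x) := by
      rw [qdet_fin_two]
      simp only [map_sub, map_smul, map_mul, hlD, Algebra.TensorProduct.tmul_mul_tmul,
        TensorProduct.tmul_sub, TensorProduct.tmul_smul]
    have hlDinv : lD dInv = (((t 0 * t 1)⁻¹ : Dˣ) : D) ⊗ₜ dInv := by
      refine left_inv_eq_right_inv (a := lD (ι (qdet q x))) ?_ ?_
      · rw [← map_mul, hd2, map_one]
      · rw [hlDdet, Algebra.TensorProduct.tmul_mul_tmul, hd1, ← Units.val_mul, Units.mul_inv]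
        rfl
    have hcomp : lD.comp s = (Algebra.TensorProduct.map ν s).comp lK := extSL _ _ _ fun i j => by
      rw [AlgHom.comp_apply, AlgHom.comp_apply, hlK, Algebra.TensorProduct.map_tmul, hsx,
        map_mul, hlD]
      fin_cases i
      · change lD dInv * _ = ν (.T 1) ⊗ₜ (dInv * _)
        rw [hlDinv, Algebra.TensorProduct.tmul_mul_tmul, hν]
        congr 1
        simp [mul_comm, ← Units.val_mul]
      · change lD 1 * _ = ν (.T (-1)) ⊗ₜ (1 * _)
        rw [map_one, one_mul, one_mul, hν]
        simp
    have h' := DFunLike.congr_fun hcomp h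
    rw [AlgHom.comp_apply, AlgHom.comp_apply, (memK h).1 hh, Algebra.TensorProduct.map_tmul,
      map_one] at h'
    exact (memD _).2 h'
end
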